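/- Recursive belief Lipschitz bound for the exact value function: suppose ObsProb(o|b,a) > 0 for all b ∈ Δ_M, a ∈ A, o ∈ O, that there exist constants C_P ≥ 0 and C_τ ≥ 0 with |ObsProb(o|b,a) − ObsProb(o|b',a)| ≤ C_P·‖b − b'‖_∞ and ‖τ(b,a,o) − τ(b',a,o)‖_∞ ≤ C_τ·‖b − b'‖_∞ for all b,b', a, o, and that W : Δ_M → ℝ is bounded and L-Lipschitz with respect to ‖·‖_∞. Then the one-step Bellman backup V(b) := max{ max_i b(i), max_{a∈A} ( −c_meas + Σ_{o∈O} ObsProb(o|b,a)·W(τ(b,a,o)) ) } is Lipschitz on Δ_M with respect to ‖·‖_∞ with constant at most max{ 1, |O|·( C_P·‖W‖_∞ + L·C_τ ) }. -/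

import Mathlib

open Finset ComplexOrder

/-- The belief simplex `Δ_M ⊆ ℝ^M`. -/
def simplex (M : ℕ) : Set (Fin M → ℝ) :=
  {b | (∀ i, 0 ≤ b i) ∧ ∑ i, b i = 1}

/-- The real number `Re Tr(E ρ)`, the Born-rule likelihood value. -/
noncomputable def trRe {d : ℕ} (E ρ : Matrix (Fin d) (Fin d) ℂ) : ℝ :=
  ((E * ρ).trace).re

/-- Observation probability `ObsProb(o | b, a) = Σ_j b j · Tr(E_o^{(a)} ρ_j)`. -/
noncomputable def obsProb {d M : ℕ} {O A : Type}
    (E : A → O → Matrix (Fin d) (Fin d) ℂ)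
    (ρ : Fin M → Matrix (Fin d) (Fin d) ℂ)
    (o : O) (b : Fin M → ℝ) (a : A) : ℝ :=
  ∑ j, b j * trRe (E a o) (ρ j)

/-- Bayesian posterior `τ(b,a,o)(i) = b i · Tr(E_o^{(a)} ρ_i) / ObsProb(o|b,a)`
(junk value when `ObsProb(o|b,a) = 0`, which only ever appears multiplied by a zero
observation probability). -/
noncomputable def bayes {d M : ℕ} {O A : Type}
    (E : A → O → Matrix (Fin d) (Fin d) ℂ)
    (ρ : Fin M → Matrix (Fin d) (Fin d) ℂ)
    (b : Fin M → ℝ) (a : A) (o : O) : Fin M → ℝ :=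
  fun i => b i * trRe (E a o) (ρ i) / obsProb E ρ o b a

/-- Stopping value `StopVal(b) = max_i b i`. -/
noncomputable def stopVal {M : ℕ} [NeZero M] (b : Fin M → ℝ) : ℝ :=
  univ.sup' univ_nonempty b

/-- Finite maxima over a common index set are nonexpansive in the uniform distance. -/
lemma abs_sup'_sub_sup'_le {ι : Type*} {s : Finset ι} (hs : s.Nonempty) {f g : ι → ℝ} {K : ℝ}
    (h : ∀ i ∈ s, |f i - g i| ≤ K) : |s.sup' hs f - s.sup' hs g| ≤ K := by
  rw [abs_sub_le_iff, sub_le_iff_le_add, sub_le_iff_le_add]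
  constructor <;> refine Finset.sup'_le hs _ fun i hi => ?_
  · linarith [(abs_sub_le_iff.1 (h i hi)).1, Finset.le_sup' g hi]
  · linarith [(abs_sub_le_iff.1 (h i hi)).2, Finset.le_sup' f hi]

lemma single_mem_simplex {M : ℕ} (i : Fin M) : Pi.single i (1 : ℝ) ∈ simplex M :=
  ⟨fun j => (Pi.single_nonneg.2 zero_le_one : (0 : Fin M → ℝ) ≤ Pi.single i 1) j, by simp⟩

lemma abs_stopVal_sub_stopVal_le {M : ℕ} [NeZero M] (b b' : Fin M → ℝ) :
    |stopVal b - stopVal b'| ≤ ‖b - b'‖ :=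
  abs_sup'_sub_sup'_le univ_nonempty fun i _ => norm_le_pi_norm (b - b') i

section Observation

variable {d M : ℕ} {O A : Type} {E : A → O → Matrix (Fin d) (Fin d) ℂ}
  {ρ : Fin M → Matrix (Fin d) (Fin d) ℂ}

lemma obsProb_single (o : O) (i : Fin M) (a : A) :
    obsProb E ρ o (Pi.single i 1) a = trRe (E a o) (ρ i) := by
  simp [obsProb, Pi.single_apply]

lemma sum_trRe [Fintype O] (hEsum : ∀ a, ∑ o, E a o = 1) (hρtr : ∀ i, (ρ i).trace = 1)
    (a : A) (i : Fin M) : ∑ o, trRe (E a o) (ρ i) = 1 := by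
  simp only [trRe]
  rw [← Complex.re_sum, ← Matrix.trace_sum, ← Finset.sum_mul, hEsum, one_mul, hρtr,
    Complex.one_re]

lemma sum_obsProb [Fintype O] (hEsum : ∀ a, ∑ o, E a o = 1) (hρtr : ∀ i, (ρ i).trace = 1)
    {b : Fin M → ℝ} (hb : b ∈ simplex M) (a : A) : ∑ o, obsProb E ρ o b a = 1 := by
  simp only [obsProb]
  rw [Finset.sum_comm]
  simp only [← Finset.mul_sum, sum_trRe hEsum hρtr, mul_one]
  exact hb.2

/-- The posterior is again a belief when the observation has positive probability. -/
lemma bayes_mem_simplex {b : Fin M → ℝ} (hb : b ∈ simplex M) {a : A} {o : O}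
    (htr : ∀ i, 0 ≤ trRe (E a o) (ρ i)) (hP : 0 < obsProb E ρ o b a) :
    bayes E ρ b a o ∈ simplex M := by
  refine ⟨fun i => div_nonneg (mul_nonneg (hb.1 i) (htr i)) hP.le, ?_⟩
  simp only [bayes]
  rw [← Finset.sum_div]
  exact div_self hP.ne'

end Observation

/-- Difference bound for a product whose second weight is at most one. -/
lemma abs_mul_sub_mul_le {p p' w w' x y B : ℝ} (hp0 : 0 ≤ p') (hp1 : p' ≤ 1)
    (hp : |p - p'| ≤ x) (hw : |w| ≤ B) (hww : |w - w'| ≤ y) :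
    |p * w - p' * w'| ≤ x * B + y := by
  calc |p * w - p' * w'| = |(p - p') * w + p' * (w - w')| := by ring_nf
    _ ≤ |p - p'| * |w| + p' * |w - w'| := by
      refine (abs_add_le _ _).trans_eq ?_
      rw [abs_mul, abs_mul, abs_of_nonneg hp0]
    _ ≤ x * B + y := by
      refine add_le_add (mul_le_mul hp hw (abs_nonneg _) ((abs_nonneg _).trans hp)) ?_
      exact (mul_le_of_le_one_left (abs_nonneg _) hp1).trans hww

/-- Recursive belief Lipschitz bound for the exact value function: under the same
regularity hypotheses, the one-step Bellman backup
`V(b) = max{ max_i b i, max_a (−c_meas + Σ_o ObsProb(o|b,a)·W(τ(b,a,o))) }`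
is Lipschitz on `Δ_M` with constant at most `max{1, |O|·(C_P·‖W‖_∞ + L·C_τ)}`. -/
theorem bellman_backup_belief_lipschitz
    (d M : ℕ) (hd : 0 < d) [NeZero M]
    (O A : Type) [Fintype O] [Nonempty O] [Fintype A] [Nonempty A]
    (ρ : Fin M → Matrix (Fin d) (Fin d) ℂ)
    (hρpsd : ∀ i, (ρ i).PosSemidef) (hρtr : ∀ i, (ρ i).trace = 1)
    (E : A → O → Matrix (Fin d) (Fin d) ℂ)
    (hEpsd : ∀ a o, (E a o).PosSemidef) (hEsum : ∀ a, ∑ o, E a o = 1)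
    (c : ℝ)
    (hpos : ∀ b ∈ simplex M, ∀ (a : A) (o : O), 0 < obsProb E ρ o b a)
    (CP Cτ : ℝ) (hCP : 0 ≤ CP) (hCτ : 0 ≤ Cτ)
    (hObsLip : ∀ b ∈ simplex M, ∀ b' ∈ simplex M, ∀ (a : A) (o : O),
      |obsProb E ρ o b a - obsProb E ρ o b' a| ≤ CP * ‖b - b'‖)
    (hPostLip : ∀ b ∈ simplex M, ∀ b' ∈ simplex M, ∀ (a : A) (o : O),
      ‖bayes E ρ b a o - bayes E ρ b' a o‖ ≤ Cτ * ‖b - b'‖)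
    (W : (Fin M → ℝ) → ℝ) (Wn : ℝ) (hWn : ∀ b ∈ simplex M, |W b| ≤ Wn)
    (L : ℝ) (hL : 0 ≤ L)
    (hWLip : ∀ b ∈ simplex M, ∀ b' ∈ simplex M, |W b - W b'| ≤ L * ‖b - b'‖) :
    ∀ b ∈ simplex M, ∀ b' ∈ simplex M,
      |max (stopVal b)
          (univ.sup' univ_nonempty fun a =>
            -c + ∑ o, obsProb E ρ o b a * W (bayes E ρ b a o)) -
        max (stopVal b')
          (univ.sup' univ_nonempty fun a =>
            -c + ∑ o, obsProb E ρ o b' a * W (bayes E ρ b' a o))|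
        ≤ max 1 ((Fintype.card O : ℝ) * (CP * Wn + L * Cτ)) * ‖b - b'‖ := by
  intro b hb b' hb'
  have htr (a : A) (o : O) (i : Fin M) : 0 ≤ trRe (E a o) (ρ i) := by
    simpa only [obsProb_single] using (hpos _ (single_mem_simplex i) a o).le
  have hτ (a : A) (o : O) := bayes_mem_simplex hb (htr a o) (hpos b hb a o)
  have hτ' (a : A) (o : O) := bayes_mem_simplex hb' (htr a o) (hpos b' hb' a o)
  have hle (a : A) (o : O) : obsProb E ρ o b' a ≤ 1 := by
    rw [← sum_obsProb hEsum hρtr hb' a]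
    exact Finset.single_le_sum (f := fun o => obsProb E ρ o b' a)
      (fun o _ => (hpos b' hb' a o).le) (Finset.mem_univ o)
  have hterm (a : A) (o : O) :
      |obsProb E ρ o b a * W (bayes E ρ b a o) - obsProb E ρ o b' a * W (bayes E ρ b' a o)|
        ≤ (CP * Wn + L * Cτ) * ‖b - b'‖ := by
    refine (abs_mul_sub_mul_le (hpos b' hb' a o).le (hle a o) (hObsLip b hb b' hb' a o)
      (hWn _ (hτ a o)) ((hWLip _ (hτ a o) _ (hτ' a o)).trans
        (mul_le_mul_of_nonneg_left (hPostLip b hb b' hb' a o) hL))).trans_eq ?_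
    ring
  refine (abs_max_sub_max_le_max _ _ _ _).trans (max_le ?_ ?_)
  · exact (abs_stopVal_sub_stopVal_le b b').trans
      (le_mul_of_one_le_left (norm_nonneg _) (le_max_left _ _))
  · refine le_trans (abs_sup'_sub_sup'_le univ_nonempty fun a _ => ?_)
      (mul_le_mul_of_nonneg_right (le_max_right _ _) (norm_nonneg _))
    rw [add_sub_add_left_eq_sub, ← Finset.sum_sub_distrib]
    refine (Finset.abs_sum_le_sum_abs _ _).trans
      ((Finset.sum_le_sum fun o _ => hterm a o).trans_eq ?_)
    rw [Finset.sum_const, Finset.card_univ, nsmul_eq_mul, mul_assoc]
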